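/- For every positive integer n, Σ_{k=0}^{n} (−1)^k C(n,k) C(n+k,k) · k · H_k^{⟨2⟩} equals (−1)^n n(n+1) (2H_n^{⟨2⟩} − H_{n/2}^{⟨2⟩}) if n is even, and (−1)^n n(n+1) (2H_n^{⟨2⟩} − H_{(n−1)/2}^{⟨2⟩} − 2/(n(n+1))) if n is odd. -/

import Mathlib

open Finset

/-- Harmonic number `H_n = ∑_{k=1}^n 1/k`. -/
noncomputable def harm (n : ℕ) : ℝ := ∑ k ∈ Finset.range n, 1 / ((k : ℝ) + 1)

/-- Second-order harmonic number `H_n^{⟨2⟩} = ∑_{k=1}^n 1/k²`. -/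
noncomputable def harm2 (n : ℕ) : ℝ := ∑ k ∈ Finset.range n, 1 / ((k : ℝ) + 1) ^ 2

/-- The coefficient of `x ^ k` in the shifted Legendre polynomial `P_n(1 - 2x)`. -/
noncomputable def legendreCoeff (n k : ℕ) : ℝ :=
  (-1 : ℝ) ^ k * (n.choose k : ℝ) * ((n + k).choose k : ℝ)

theorem legendreCoeff_zero_right (n : ℕ) : legendreCoeff n 0 = 1 := by
  simp [legendreCoeff]

theorem legendreCoeff_eq_zero_of_lt {n k : ℕ} (h : n < k) : legendreCoeff n k = 0 := by
  simp [legendreCoeff, Nat.choose_eq_zero_of_lt h]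

theorem legendreCoeff_succ_right (n k : ℕ) :
    legendreCoeff n (k + 1) * ((k : ℝ) + 1) ^ 2
      = -(((n : ℝ) - k) * ((n : ℝ) + k + 1)) * legendreCoeff n k := by
  rcases lt_or_ge n k with h | h
  · rw [legendreCoeff_eq_zero_of_lt h, legendreCoeff_eq_zero_of_lt (by omega)]
    ring
  · have h₁ : (n.choose (k + 1) : ℝ) * (k + 1) = n.choose k * (n - k) := by
      rw [← Nat.cast_sub h]
      exact_mod_cast Nat.choose_succ_right_eq n k
    have h₂ : ((n : ℝ) + k + 1) * (n + k).choose k = (n + (k + 1)).choose (k + 1) * (k + 1) := by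
      exact_mod_cast Nat.add_one_mul_choose_eq (n + k) k
    unfold legendreCoeff
    rw [pow_succ]
    linear_combination (-(-1 : ℝ) ^ k * ((n + (k + 1)).choose (k + 1) * (k + 1))) * h₁
      + ((-1 : ℝ) ^ k * (n.choose k * (n - k))) * h₂

theorem legendreCoeff_succ_left (n k : ℕ) :
    ((n : ℝ) + 1 - k) * legendreCoeff (n + 1) k = ((n : ℝ) + 1 + k) * legendreCoeff n k := by
  rcases lt_or_ge (n + 1) k with h | h
  · rw [legendreCoeff_eq_zero_of_lt h, legendreCoeff_eq_zero_of_lt (by omega)]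
    ring
  · have h₁ : (n.choose k : ℝ) * (n + 1) = (n + 1).choose k * (n + 1 - k) := by
      have := Nat.choose_mul_succ_eq n k
      rw [← Nat.cast_add_one n, ← Nat.cast_sub h]
      exact_mod_cast this
    have h₂ : ((n + k).choose k : ℝ) * (n + k + 1) = (n + 1 + k).choose k * (n + 1) := by
      have := Nat.choose_mul_succ_eq (n + k) k
      rw [show n + k + 1 - k = n + 1 by omega, show n + k + 1 = n + 1 + k by omega] at this
      rw [show (n : ℝ) + k + 1 = n + 1 + k by ring]
      exact_mod_cast this
    unfold legendreCoeff
    linear_combination (-(-1 : ℝ) ^ k * (n + 1 + k).choose k) * h₁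
      - ((-1 : ℝ) ^ k * n.choose k) * h₂

theorem legendreCoeff_add_succ (n k : ℕ) :
    (legendreCoeff (n + 1) (k + 1) + legendreCoeff n (k + 1)) * ((k : ℝ) + 1) ^ 2
        - (legendreCoeff (n + 1) k + legendreCoeff n k) * (k : ℝ) ^ 2
      = -((n : ℝ) + 1) ^ 2 * (legendreCoeff (n + 1) k + legendreCoeff n k) := by
  have h := legendreCoeff_succ_right (n + 1) k
  push_cast at h
  linear_combination h + legendreCoeff_succ_right n k - legendreCoeff_succ_left n k

theorem harm2_succ (n : ℕ) : harm2 (n + 1) = harm2 n + 1 / ((n : ℝ) + 1) ^ 2 := by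
  simp [harm2, sum_range_succ]

theorem sum_range_sub_mul_harm2 (g : ℕ → ℝ) (N : ℕ) :
    ∑ k ∈ range N, (g (k + 1) * ((k : ℝ) + 1) ^ 2 - g k * (k : ℝ) ^ 2) * harm2 k
      = g N * (N : ℝ) ^ 2 * harm2 N - ∑ k ∈ range N, g (k + 1) := by
  induction N with
  | zero => simp [harm2]
  | succ N ih =>
    rw [sum_range_succ, sum_range_succ, ih, harm2_succ]
    push_cast
    field_simp
    ring

theorem sum_range_sub_mul_sq (g : ℕ → ℝ) (N : ℕ) :
    ∑ k ∈ range N, (g (k + 1) * ((k : ℝ) + 1) ^ 2 - g k * (k : ℝ) ^ 2) = g N * (N : ℝ) ^ 2 := by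
  have h := sum_range_sub (fun k : ℕ => g k * (k : ℝ) ^ 2) N
  push_cast at h
  linear_combination h

theorem sum_legendreCoeff_mul_of_le (f : ℕ → ℝ) {n N : ℕ} (h : n + 1 ≤ N) :
    ∑ k ∈ range N, legendreCoeff n k * f k = ∑ k ∈ range (n + 1), legendreCoeff n k * f k := by
  symm
  refine sum_subset (range_mono h) fun k _ hk => ?_
  rw [legendreCoeff_eq_zero_of_lt (by simpa using hk), zero_mul]

theorem sum_legendreCoeff_add (n : ℕ) :
    ∑ k ∈ range (n + 2), (legendreCoeff (n + 1) k + legendreCoeff n k) = 0 := by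
  have h := sum_range_sub_mul_sq (fun k => legendreCoeff (n + 1) k + legendreCoeff n k) (n + 2)
  simp only [legendreCoeff_add_succ, ← mul_sum] at h
  rw [legendreCoeff_eq_zero_of_lt (by omega : n + 1 < n + 2),
    legendreCoeff_eq_zero_of_lt (by omega : n < n + 2), add_zero, zero_mul] at h
  exact (mul_eq_zero.mp h).resolve_left (neg_ne_zero.mpr (by positivity))

theorem sum_legendreCoeff (n : ℕ) :
    ∑ k ∈ range (n + 1), legendreCoeff n k = (-1 : ℝ) ^ n := by
  induction n with
  | zero => simp [legendreCoeff]
  | succ n ih =>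
    have h := sum_legendreCoeff_add n
    have h' := sum_legendreCoeff_mul_of_le (fun _ => 1) (by omega : n + 1 ≤ n + 2)
    simp only [mul_one] at h'
    rw [sum_add_distrib, h', ih] at h
    rw [pow_succ]
    linear_combination h

theorem sum_legendreCoeff_mul_harm2_add (n : ℕ) :
    ∑ k ∈ range (n + 2), legendreCoeff (n + 1) k * harm2 k
        + ∑ k ∈ range (n + 1), legendreCoeff n k * harm2 k
      = -2 / ((n : ℝ) + 1) ^ 2 := by
  have h := sum_range_sub_mul_harm2 (fun k => legendreCoeff (n + 1) k + legendreCoeff n k) (n + 2)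
  have h₀ := sum_legendreCoeff_add n
  have h₁ := sum_range_succ' (fun k => legendreCoeff (n + 1) k + legendreCoeff n k) (n + 2)
  rw [sum_range_succ, h₀] at h₁
  simp only [legendreCoeff_add_succ, mul_assoc, ← mul_sum] at h
  rw [← sum_legendreCoeff_mul_of_le harm2 (by omega : n + 1 ≤ n + 2), ← sum_add_distrib]
  simp only [add_mul] at h
  simp only [legendreCoeff_zero_right, legendreCoeff_eq_zero_of_lt (by omega : n + 1 < n + 2),
    legendreCoeff_eq_zero_of_lt (by omega : n < n + 2)] at h h₁
  rw [eq_div_iff (by positivity)]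
  linear_combination -h - h₁

theorem sum_legendreCoeff_mul_harm2 (n : ℕ) :
    ∑ k ∈ range (n + 1), legendreCoeff n k * harm2 k
      = (-1 : ℝ) ^ n * (2 * harm2 n - harm2 (n / 2)) := by
  induction n with
  | zero => simp [harm2]
  | succ n ih =>
    have h := sum_legendreCoeff_mul_harm2_add n
    rw [ih] at h
    rw [← eq_sub_iff_add_eq] at h
    rw [h, harm2_succ]
    rcases Nat.even_or_odd' n with ⟨m, rfl | rfl⟩
    · rw [show (2 * m + 1) / 2 = m by omega, show 2 * m / 2 = m by omega]
      simp only [pow_succ, pow_mul]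
      norm_num
      field_simp
      ring
    · rw [show (2 * m + 1 + 1) / 2 = m + 1 by omega, show (2 * m + 1) / 2 = m by omega,
        harm2_succ m]
      have hm : ((2 * m + 1 : ℕ) : ℝ) + 1 = 2 * (m + 1) := by push_cast; ring
      rw [hm]
      simp only [pow_succ, pow_mul]
      norm_num
      field_simp
      ring

theorem sum_legendreCoeff_mul_self_mul_harm2 (n : ℕ) :
    ∑ k ∈ range (n + 1), legendreCoeff n k * k * harm2 k
      = (n : ℝ) * (n + 1) * ∑ k ∈ range (n + 1), legendreCoeff n k * harm2 k + 1 - (-1 : ℝ) ^ n := by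
  have h := sum_range_sub_mul_harm2 (legendreCoeff n) (n + 1)
  have h₁ := sum_range_succ' (legendreCoeff n) (n + 1)
  rw [sum_range_succ, sum_legendreCoeff] at h₁
  simp only [legendreCoeff_zero_right, legendreCoeff_eq_zero_of_lt (Nat.lt_succ_self n)] at h h₁
  have h₂ : ∑ k ∈ range (n + 1),
        (legendreCoeff n (k + 1) * ((k : ℝ) + 1) ^ 2 - legendreCoeff n k * (k : ℝ) ^ 2) * harm2 k
      = ∑ k ∈ range (n + 1), legendreCoeff n k * k * harm2 k
        - (n : ℝ) * (n + 1) * ∑ k ∈ range (n + 1), legendreCoeff n k * harm2 k := by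
    rw [mul_sum, ← sum_sub_distrib]
    refine sum_congr rfl fun k _ => ?_
    rw [legendreCoeff_succ_right]
    ring
  rw [h₂] at h
  linear_combination h + h₁

theorem stmt13 (n : ℕ) (hn : 0 < n) :
    ∑ k ∈ Finset.range (n + 1),
      (-1 : ℝ) ^ k * (n.choose k : ℝ) * ((n + k).choose k : ℝ) * (k : ℝ) * harm2 k
    = if n % 2 = 0 then
        (-1 : ℝ) ^ n * (n : ℝ) * ((n : ℝ) + 1) * (2 * harm2 n - harm2 (n / 2))
      else
        (-1 : ℝ) ^ n * (n : ℝ) * ((n : ℝ) + 1) *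
          (2 * harm2 n - harm2 ((n - 1) / 2) - 2 / ((n : ℝ) * ((n : ℝ) + 1))) := by
  have h := sum_legendreCoeff_mul_self_mul_harm2 n
  rw [sum_legendreCoeff_mul_harm2] at h
  unfold legendreCoeff at h
  rw [h]
  split_ifs with hpar
  · rw [(Nat.even_iff.mpr hpar).neg_one_pow]
    ring
  · have hodd : Odd n := Nat.odd_iff.mpr (by omega)
    rw [hodd.neg_one_pow, show (n - 1) / 2 = n / 2 by omega]
    have hn' : (n : ℝ) ≠ 0 := by positivity
    field_simp
    ring
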